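/- Let R be a reduced Noetherian ring whose normalization R^N is module-finite over R, with conductor c = Ann_R(R^N/R), let D = (R/√(c R))^SN ∩ (R^N/√(c R^N)), and let C be the pullback of R^N → R^N/√(c R^N) ← D. Then C embeds into R^N, the induced map R^SN → C is birational (an injection inducing an isomorphism of total rings of fractions), and, since R^SN is seminormal and R^SN → C is finite, birational, bijective on prime spectra, and induces isomorphisms of residue fields, the map R^SN → C is an isomorphism. -/

import Mathlib

universe u v

set_option synthInstance.maxHeartbeats 1000000
set_option maxHeartbeats 1000000

/-- A ring homomorphism is *birational* if it carries nonzerodivisors to nonzerodivisors and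
the induced map on total rings of fractions is bijective. -/
def IsBirationalHom {A : Type u} {B : Type v} [CommRing A] [CommRing B] (f : A →+* B) : Prop :=
  ∃ hle : nonZeroDivisors A ≤ Submonoid.comap f (nonZeroDivisors B),
    Function.Bijective
      (IsLocalization.map (M := nonZeroDivisors A) (T := nonZeroDivisors B)
        (FractionRing B) f hle : FractionRing A →+* FractionRing B)

/-- A ring homomorphism induces isomorphisms of all residue fields if for every prime `q`
of the target, the induced map on residue fields `κ(q.comap f) → κ(q)` is bijective. -/
def InducesResidueFieldIsos {A : Type u} {B : Type v} [CommRing A] [CommRing B]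
    (f : A →+* B) : Prop :=
  ∀ (q : Ideal B) [q.IsPrime],
    Function.Bijective
      (IsLocalRing.ResidueField.map (Localization.localRingHom (q.comap f) q f rfl))

/-- A commutative ring `A` is seminormal if every finite birational (injective) extension
which induces a bijection on prime spectra and isomorphisms of all residue fields is an
isomorphism. -/
def IsSeminormalRing (A : Type u) [CommRing A] : Prop :=
  ∀ (B : Type u) [CommRing B] (f : A →+* B),
    Function.Injective f → f.Finite → IsBirationalHom f →
    Function.Bijective (PrimeSpectrum.comap f) →
    InducesResidueFieldIsos f →
    Function.Bijective f

/-- `S` is the seminormalization of `R` if it is the smallest seminormal intermediate ring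
between `R` and the normalization `R^N` (the integral closure of `R` in its total ring of
fractions). -/
def IsSeminormalization (R : Type u) [CommRing R]
    (S : Subalgebra R (FractionRing R)) : Prop :=
  S ≤ integralClosure R (FractionRing R) ∧ IsSeminormalRing S ∧
    ∀ T : Subalgebra R (FractionRing R),
      T ≤ integralClosure R (FractionRing R) → IsSeminormalRing T → S ≤ T

/-- The conductor `Ann_R (R^N / R)` of a commutative ring in its normalization. -/
noncomputable def conductorIdeal (R : Type u) [CommRing R] : Ideal R :=
  Module.annihilator R
    (↥(integralClosure R (FractionRing R)) ⧸
      LinearMap.range (Algebra.linearMap R ↥(integralClosure R (FractionRing R))))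

/-- The pullback (fiber product) of a diagram of ring maps `A → T ← B`, realized as the
subring of `A × B` of pairs with equal images in `T`. -/
def ringPullback {A : Type u} {B : Type v} {T : Type*} [CommRing A] [CommRing B] [CommRing T]
    (f : A →+* T) (g : B →+* T) : Subring (A × B) :=
  RingHom.eqLocus (f.comp (RingHom.fst A B)) (g.comp (RingHom.snd A B))
/-- `R/√(cR)` where `c` is the conductor. -/
noncomputable def AQuot (R : Type u) [CommRing R] : Type u :=
  R ⧸ (conductorIdeal R).radical

noncomputable instance (R : Type u) [CommRing R] : CommRing (AQuot R) :=
  inferInstanceAs (CommRing (R ⧸ (conductorIdeal R).radical))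

/-- `R^N/√(c R^N)` where `c` is the conductor. -/
noncomputable def NQuot (R : Type u) [CommRing R] : Type u :=
  ↥(integralClosure R (FractionRing R)) ⧸
    ((conductorIdeal R).map
      (algebraMap R ↥(integralClosure R (FractionRing R)))).radical

noncomputable instance (R : Type u) [CommRing R] : CommRing (NQuot R) :=
  inferInstanceAs (CommRing (↥(integralClosure R (FractionRing R)) ⧸
    ((conductorIdeal R).map
      (algebraMap R ↥(integralClosure R (FractionRing R)))).radical))

/-- The quotient map `R^N → R^N/√(c R^N)`. -/
noncomputable def nQuotMk (R : Type u) [CommRing R] :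
    ↥(integralClosure R (FractionRing R)) →+* NQuot R :=
  Ideal.Quotient.mk _

/-- The quotient map `R → R/√(cR)`. -/
noncomputable def aQuotMk (R : Type u) [CommRing R] : R →+* AQuot R :=
  Ideal.Quotient.mk _

/-- The natural map `R/√(cR) → R^N/√(c R^N)`. -/
noncomputable def condQuotMap (R : Type u) [CommRing R] : AQuot R →+* NQuot R :=
  Ideal.Quotient.lift _
    ((nQuotMk R).comp (algebraMap R ↥(integralClosure R (FractionRing R))))
    (fun a ha => Ideal.Quotient.eq_zero_iff_mem.mpr
      (Ideal.map_radical_le (f := algebraMap R ↥(integralClosure R (FractionRing R)))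
        (Ideal.mem_map_of_mem _ ha)))

/-- The natural map `R/c → R^N/(c R^N)`. -/
noncomputable def plainCondQuotMap (R : Type u) [CommRing R] :
    R ⧸ conductorIdeal R →+*
      (↥(integralClosure R (FractionRing R)) ⧸
        (conductorIdeal R).map (algebraMap R ↥(integralClosure R (FractionRing R)))) :=
  Ideal.Quotient.lift _
    ((Ideal.Quotient.mk _).comp (algebraMap R ↥(integralClosure R (FractionRing R))))
    (fun a ha => Ideal.Quotient.eq_zero_iff_mem.mpr (Ideal.mem_map_of_mem _ ha))

/-- Elementwise form of: injective on spectra, with isomorphisms of residue fields. -/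
def SubI {A : Type u} {B : Type v} [CommRing A] [CommRing B] (f : A →+* B) : Prop :=
  ∀ p : Ideal A, p.IsPrime → ∀ b : B, ∃ s a : A, s ∉ p ∧
    ∀ q : Ideal B, q.IsPrime → q.comap f = p → f s * b - f a ∈ q

section
variable {A : Type*} {B : Type*} [CommRing A] [CommRing B]

lemma SubI.comap_injective {f : A →+* B} (h : SubI f) :
    Function.Injective (PrimeSpectrum.comap f) := by
  have key : ∀ q₁ q₂ : PrimeSpectrum B, PrimeSpectrum.comap f q₁ = PrimeSpectrum.comap f q₂ →
      q₁.asIdeal ≤ q₂.asIdeal := by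
    intro q₁ q₂ hq b hb
    have hq' : q₁.asIdeal.comap f = q₂.asIdeal.comap f := congrArg PrimeSpectrum.asIdeal hq
    have := q₁.2
    have := q₂.2
    obtain ⟨s, a, hs, H⟩ := h (q₂.asIdeal.comap f) inferInstance b
    have h1 := H q₁.asIdeal q₁.2 hq'
    have h2 := H q₂.asIdeal q₂.2 rfl
    have ha : f a ∈ q₁.asIdeal := by
      have := sub_mem (q₁.asIdeal.mul_mem_left (f s) hb) h1
      simpa using this
    have ha2 : f a ∈ q₂.asIdeal := by
      have : a ∈ q₁.asIdeal.comap f := ha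
      rw [hq'] at this
      exact this
    have h3 : f s * b ∈ q₂.asIdeal := by
      have := add_mem h2 ha2
      simpa using this
    exact (q₂.2.mem_or_mem h3).resolve_left hs
  intro q₁ q₂ hq
  exact PrimeSpectrum.ext (le_antisymm (key _ _ hq) (key _ _ hq.symm))

lemma SubI.residue {f : A →+* B} (h : SubI f) : InducesResidueFieldIsos f := by
  intro q hq
  refine ⟨RingHom.injective _, ?_⟩
  intro y
  obtain ⟨y, rfl⟩ := IsLocalRing.residue_surjective y
  obtain ⟨⟨b, t⟩, rfl⟩ := IsLocalization.mk'_surjective q.primeCompl y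
  obtain ⟨s, a, hs, H⟩ := h (q.comap f) inferInstance b
  obtain ⟨s', a', hs', H'⟩ := h (q.comap f) inferInstance (t : B)
  have H1 := H q hq rfl
  have H2 := H' q hq rfl
  have ha' : a' ∉ q.comap f := by
    intro hc
    have : f s' * t ∈ q := by
      have := add_mem H2 (show f a' ∈ q from hc)
      simpa using this
    rcases hq.mem_or_mem this with h1 | h1
    · exact hs' h1
    · exact t.2 h1
  have hsa : s * a' ∈ (q.comap f).primeCompl := by
    intro hc
    rcases (inferInstance : (q.comap f).IsPrime).mem_or_mem hc with h1 | h1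
    · exact hs h1
    · exact ha' h1
  refine ⟨IsLocalRing.residue _ (IsLocalization.mk' _ (a * s') (⟨s * a', hsa⟩ : (q.comap f).primeCompl)), ?_⟩
  rw [IsLocalRing.ResidueField.map_residue, Localization.localRingHom_mk']
  rw [← sub_eq_zero, ← map_sub, IsLocalRing.residue_eq_zero_iff]
  rw [← IsLocalization.mk'_sub, IsLocalization.AtPrime.mk'_mem_maximal_iff _ q]
  have : f (a * s') * (t : B) - f (s * a') * b =
      - (f s' * t) * (f s * b - f a) + (f s * b) * (f s' * t - f a') := by
    simp only [map_mul]; ring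
  have h4 : f (a * s') * (t : B) - f (s * a') * b ∈ q := by
    rw [this]
    exact add_mem (q.mul_mem_left _ H1) (q.mul_mem_left _ H2)
  convert h4 using 1
  simp [mul_comm]

lemma subI_of {f : A →+* B} (hi : Function.Injective (PrimeSpectrum.comap f))
    (hr : InducesResidueFieldIsos f) : SubI f := by
  intro p hp b
  by_cases hex : ∃ q : Ideal B, q.IsPrime ∧ q.comap f = p
  · obtain ⟨q, hq, rfl⟩ := hex
    obtain ⟨x, hx⟩ := (hr q).2 (IsLocalRing.residue _ (algebraMap B (Localization.AtPrime q) b))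
    obtain ⟨x, rfl⟩ := IsLocalRing.residue_surjective x
    obtain ⟨⟨a, s⟩, rfl⟩ := IsLocalization.mk'_surjective (q.comap f).primeCompl x
    refine ⟨s, a, s.2, ?_⟩
    intro q' hq' hqq
    have : q' = q := by
      have : (⟨q', hq'⟩ : PrimeSpectrum B) = ⟨q, hq⟩ := hi (PrimeSpectrum.ext hqq)
      exact congrArg PrimeSpectrum.asIdeal this
    subst this
    rw [IsLocalRing.ResidueField.map_residue, Localization.localRingHom_mk'] at hx
    rw [← sub_eq_zero, ← map_sub, IsLocalRing.residue_eq_zero_iff] at hx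
    have h2 := Ideal.mul_mem_left _ (algebraMap B (Localization.AtPrime q') (f s)) hx
    have hm := IsLocalization.mk'_spec' (Localization.AtPrime q') (f a)
      (⟨f s, s.2⟩ : q'.primeCompl)
    have h2' : algebraMap B (Localization.AtPrime q') (f a - f s * b) ∈
        IsLocalRing.maximalIdeal (Localization.AtPrime q') := by
      rw [map_sub, map_mul, ← hm, ← mul_sub]
      exact h2
    have h3 := (IsLocalization.AtPrime.to_map_mem_maximal_iff (Localization.AtPrime q') q' _).1 h2'
    have := neg_mem h3
    simpa using this
  · push Not at hex
    exact ⟨1, 0, fun h => hp.ne_top ((Ideal.eq_top_iff_one _).2 h), fun q hq h => absurd h (hex q hq)⟩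

lemma SubI.comp {C : Type*} [CommRing C] {f : A →+* B} {g : B →+* C} (hf : SubI f) (hg : SubI g) :
    SubI (g.comp f) := by
  refine subI_of ?_ ?_
  · rw [PrimeSpectrum.comap_comp]
    exact hf.comap_injective.comp hg.comap_injective
  · apply SubI.residue
    intro p hp c
    by_cases hex : ∃ q : Ideal B, q.IsPrime ∧ q.comap f = p
    · obtain ⟨p', hp', rfl⟩ := hex
      obtain ⟨s', a', hs', H'⟩ := hg p' hp' c
      obtain ⟨s₁, a₁, hs₁, H₁⟩ := hf _ hp s'
      obtain ⟨s₂, a₂, hs₂, H₂⟩ := hf _ hp a'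
      have K₁ := H₁ p' hp' rfl
      have K₂ := H₂ p' hp' rfl
      refine ⟨s₂ * a₁, s₁ * a₂, ?_, ?_⟩
      · intro hc
        rcases hp.mem_or_mem hc with h | h
        · exact hs₂ h
        · have : f s₁ * s' ∈ p' := by simpa using add_mem K₁ (show f a₁ ∈ p' from h)
          rcases hp'.mem_or_mem this with h | h
          · exact hs₁ h
          · exact hs' h
      · intro q hq hqp
        have : q.comap g = p' := by
          have : (⟨q.comap g, inferInstance⟩ : PrimeSpectrum B) = ⟨p', hp'⟩ :=
            hf.comap_injective (PrimeSpectrum.ext hqp)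
          exact congrArg PrimeSpectrum.asIdeal this
        have L := H' q hq this
        have L₁ : g (f s₁ * s' - f a₁) ∈ q := by rw [← this] at K₁; exact K₁
        have L₂ : g (f s₂ * a' - f a₂) ∈ q := by rw [← this] at K₂; exact K₂
        have e : (g.comp f) (s₂ * a₁) * c - (g.comp f) (s₁ * a₂) =
            (g (f s₁) * g (f s₂)) * (g s' * c - g a') - (g (f s₂) * c) * g (f s₁ * s' - f a₁)
            + g (f s₁) * g (f s₂ * a' - f a₂) := by
          simp; ring
        rw [e]
        exact add_mem (sub_mem (q.mul_mem_left _ L) (q.mul_mem_left _ L₁)) (q.mul_mem_left _ L₂)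
    · push Not at hex
      exact ⟨1, 0, fun h => hp.ne_top ((Ideal.eq_top_iff_one _).2 h),
        fun q hq h => absurd h (hex (q.comap g) inferInstance)⟩

end

section
variable (A : Type u) [CommRing A]

/-- Elements of the normalization which are rational at each prime. -/
def goodSub : Subalgebra A (FractionRing A) where
  carrier := {x | ∃ hx : x ∈ integralClosure A (FractionRing A),
    ∀ p : Ideal A, p.IsPrime → ∃ s a : A, s ∉ p ∧
      ∀ q : Ideal (integralClosure A (FractionRing A)), q.IsPrime → q.comap (algebraMap A _) = p →
        algebraMap A _ s * ⟨x, hx⟩ - algebraMap A _ a ∈ q}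
  mul_mem' := by
    rintro x y ⟨hx, Hx⟩ ⟨hy, Hy⟩
    refine ⟨mul_mem hx hy, fun p hp => ?_⟩
    obtain ⟨s, a, hs, H⟩ := Hx p hp
    obtain ⟨s', a', hs', H'⟩ := Hy p hp
    refine ⟨s * s', a * a', fun h => (hp.mem_or_mem h).elim hs hs', fun q hq hqp => ?_⟩
    have e : algebraMap A (integralClosure A (FractionRing A)) (s * s') * ⟨x * y, mul_mem hx hy⟩
        - algebraMap A _ (a * a') =
        (algebraMap A _ s * ⟨x, hx⟩) * (algebraMap A _ s' * ⟨y, hy⟩ - algebraMap A _ a')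
        + algebraMap A _ a' * (algebraMap A _ s * ⟨x, hx⟩ - algebraMap A _ a) := by
      have : (⟨x * y, mul_mem hx hy⟩ : integralClosure A (FractionRing A)) = ⟨x, hx⟩ * ⟨y, hy⟩ := rfl
      rw [this, map_mul, map_mul]; ring
    rw [e]
    exact add_mem (q.mul_mem_left _ (H' q hq hqp)) (q.mul_mem_left _ (H q hq hqp))
  add_mem' := by
    rintro x y ⟨hx, Hx⟩ ⟨hy, Hy⟩
    refine ⟨add_mem hx hy, fun p hp => ?_⟩
    obtain ⟨s, a, hs, H⟩ := Hx p hp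
    obtain ⟨s', a', hs', H'⟩ := Hy p hp
    refine ⟨s * s', s' * a + s * a', fun h => (hp.mem_or_mem h).elim hs hs', fun q hq hqp => ?_⟩
    have e : algebraMap A (integralClosure A (FractionRing A)) (s * s') * ⟨x + y, add_mem hx hy⟩
        - algebraMap A _ (s' * a + s * a') =
        algebraMap A _ s * (algebraMap A _ s' * ⟨y, hy⟩ - algebraMap A _ a')
        + algebraMap A _ s' * (algebraMap A _ s * ⟨x, hx⟩ - algebraMap A _ a) := by
      have : (⟨x + y, add_mem hx hy⟩ : integralClosure A (FractionRing A)) = ⟨x, hx⟩ + ⟨y, hy⟩ := rfl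
      rw [this, map_mul, map_add, map_mul, map_mul]; ring
    rw [e]
    exact add_mem (q.mul_mem_left _ (H' q hq hqp)) (q.mul_mem_left _ (H q hq hqp))
  algebraMap_mem' := by
    intro r
    refine ⟨Subalgebra.algebraMap_mem _ r, fun p hp => ⟨1, r,
      fun h => hp.ne_top ((Ideal.eq_top_iff_one _).2 h), fun q hq hqp => ?_⟩⟩
    have : (⟨algebraMap A (FractionRing A) r, Subalgebra.algebraMap_mem _ r⟩ :
      integralClosure A (FractionRing A)) = algebraMap A _ r := rfl
    rw [this]; simp

lemma goodSub_le : goodSub A ≤ integralClosure A (FractionRing A) := fun _ h => h.1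

variable {A}

/-- Lifting primes along injective integral maps. -/
lemma exists_prime_over {B C : Type*} [CommRing B] [CommRing C] (f : B →+* C)
    (hf : Function.Injective f) (hi : f.IsIntegral) (q : Ideal B) (hq : q.IsPrime) :
    ∃ Q : Ideal C, Q.IsPrime ∧ Q.comap f = q := by
  obtain ⟨Q, hQ⟩ := hi.comap_surjective hf ⟨q, hq⟩
  exact ⟨Q.asIdeal, Q.2, congrArg PrimeSpectrum.asIdeal hQ⟩

end

section
variable {A : Type u} [CommRing A]

lemma isUnit_of_nzd (T : Subalgebra A (FractionRing A)) (t : T) (ht : t ∈ nonZeroDivisors T) :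
    IsUnit (t : FractionRing A) := by
  obtain ⟨⟨a, s⟩, hs⟩ := IsLocalization.surj (nonZeroDivisors A) (t : FractionRing A)
  have hs' : (t : FractionRing A) * algebraMap A (FractionRing A) s
    = algebraMap A (FractionRing A) a := hs
  have ha : a ∈ nonZeroDivisors A := by
    rw [mem_nonZeroDivisors_iff_right]
    intro x hx
    have h1 : (algebraMap A T (x * s)) * t = 0 := by
      apply Subtype.ext
      change algebraMap A (FractionRing A) (x * s) * (t : FractionRing A) = 0
      rw [map_mul, mul_assoc, mul_comm (algebraMap A (FractionRing A) s), hs', ← map_mul, hx,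
        map_zero]
    have h2 := (mem_nonZeroDivisors_iff_right.1 ht) _ h1
    have h3 : algebraMap A (FractionRing A) (x * s) = 0 := congrArg Subtype.val h2
    have h4 : x * s = 0 := by
      apply IsFractionRing.injective A (FractionRing A)
      rw [h3, map_zero]
    exact (mem_nonZeroDivisors_iff_right.1 s.2) _ h4
  have h5 : IsUnit (algebraMap A (FractionRing A) a) :=
    IsLocalization.map_units (FractionRing A) (⟨a, ha⟩ : nonZeroDivisors A)
  rw [← hs'] at h5
  exact isUnit_of_mul_isUnit_left h5

/-- A birational injective extension of an intermediate ring embeds into the fraction ring. -/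
lemma exists_embed (T : Subalgebra A (FractionRing A)) {B : Type*} [CommRing B] (f : T →+* B)
    (hf : IsBirationalHom f) : ∃ φ : B →+* FractionRing A, Function.Injective φ ∧
      ∀ t : T, φ (f t) = t := by
  obtain ⟨hle, hb⟩ := hf
  let e := RingEquiv.ofBijective _ hb
  let l : FractionRing T →+* FractionRing A :=
    IsLocalization.lift (M := nonZeroDivisors T) (g := T.val.toRingHom)
      (fun y => isUnit_of_nzd T y.1 y.2)
  have hl : Function.Injective l := by
    rw [injective_iff_map_eq_zero]
    intro x hx
    obtain ⟨⟨a, s⟩, rfl⟩ := IsLocalization.mk'_surjective (nonZeroDivisors T) x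
    have hx2 := (IsLocalization.lift_mk'_spec (M := nonZeroDivisors T) (g := T.val.toRingHom)
      (fun y => isUnit_of_nzd T y.1 y.2) a 0 s).1 hx
    have : a = 0 := by
      apply Subtype.ext
      rw [mul_zero] at hx2
      exact hx2
    change IsLocalization.mk' (FractionRing T) a s = 0
    rw [this, IsLocalization.mk'_zero]
  refine ⟨l.comp ((e.symm : FractionRing B →+* FractionRing T).comp
    (algebraMap B (FractionRing B))), ?_, ?_⟩
  · exact hl.comp (e.symm.injective.comp (IsFractionRing.injective B (FractionRing B)))
  · intro t
    have h1 : e (algebraMap T (FractionRing T) t) = algebraMap B (FractionRing B) (f t) :=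
      IsLocalization.map_eq (M := nonZeroDivisors T) (S := FractionRing T)
        (Q := FractionRing B) hle t
    have h2 : e.symm (algebraMap B (FractionRing B) (f t)) = algebraMap T (FractionRing T) t := by
      rw [← h1, e.symm_apply_apply]
    change l (e.symm (algebraMap B (FractionRing B) (f t))) = _
    rw [h2]
    exact IsLocalization.lift_eq _ _

lemma subI_of_le_goodSub (T : Subalgebra A (FractionRing A)) (hT : T ≤ goodSub A) :
    SubI (algebraMap A T) := by
  intro p hp b
  obtain ⟨hb, H⟩ := hT b.2
  obtain ⟨s, a, hs, H⟩ := H p hp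
  refine ⟨s, a, hs, fun q hq hqp => ?_⟩
  have hTE : T ≤ integralClosure A (FractionRing A) := hT.trans (goodSub_le A)
  let i : T →+* integralClosure A (FractionRing A) := (Subalgebra.inclusion hTE).toRingHom
  have hi : i.IsIntegral := by
    apply RingHom.IsIntegral.tower_top (algebraMap A T)
    have : i.comp (algebraMap A T) = algebraMap A _ := rfl
    rw [this]
    exact fun x => Algebra.IsIntegral.isIntegral x
  obtain ⟨Q, hQ, rfl⟩ := exists_prime_over i (Subalgebra.inclusion_injective hTE) hi q hq
  exact H Q hQ hqp

lemma goodSub_seminormal : IsSeminormalRing (goodSub A) := by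
  intro B _ f hinj hfin hbir hspec hres
  refine ⟨hinj, ?_⟩
  obtain ⟨φ, hφ, hφf⟩ := exists_embed (goodSub A) f hbir
  have hS : SubI (f.comp (algebraMap A (goodSub A))) :=
    (subI_of_le_goodSub _ le_rfl).comp (subI_of hspec.1 hres)
  have hfi : (f.comp (algebraMap A (goodSub A))).IsIntegral := by
    apply RingHom.IsIntegral.trans
    · intro x
      have h1 : IsIntegral A (x : FractionRing A) := goodSub_le A x.2
      exact (isIntegral_algHom_iff (goodSub A).val Subtype.val_injective).1 h1
    · exact hfin.to_isIntegral
  have hcomp : φ.comp (f.comp (algebraMap A (goodSub A))) = algebraMap A (FractionRing A) := by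
    ext a
    exact hφf _
  have hmem : ∀ b, φ b ∈ integralClosure A (FractionRing A) := by
    intro b
    change (algebraMap A (FractionRing A)).IsIntegralElem (φ b)
    rw [← hcomp]
    exact (hfi b).map φ
  let ψ : B →+* integralClosure A (FractionRing A) :=
    φ.codRestrict (integralClosure A (FractionRing A)).toSubring hmem
  have hψ : ψ.comp (f.comp (algebraMap A (goodSub A))) = algebraMap A _ := by
    ext a
    exact congrArg (fun h => h a) hcomp
  intro b
  have hgood : φ b ∈ goodSub A := by
    refine ⟨hmem b, fun p hp => ?_⟩
    obtain ⟨s, a, hs, H⟩ := hS p hp b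
    refine ⟨s, a, hs, fun Q hQ hQp => ?_⟩
    have := H (Q.comap ψ) inferInstance (by rw [Ideal.comap_comap, hψ, hQp])
    rw [Ideal.mem_comap, map_sub, map_mul] at this
    rw [← hψ]
    exact this
  refine ⟨⟨φ b, hgood⟩, hφ ?_⟩
  rw [hφf]

lemma IsSeminormalization.subI {S : Subalgebra A (FractionRing A)}
    (h : IsSeminormalization A S) : SubI (algebraMap A S) :=
  subI_of_le_goodSub S (h.2.2 _ (goodSub_le A) goodSub_seminormal)

lemma birational_of {B : Type*} {C : Type*} [CommRing B] [CommRing C] (f : B →+* C)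
    (hinj : Function.Injective f)
    (hle : nonZeroDivisors B ≤ Submonoid.comap f (nonZeroDivisors C))
    (H : ∀ c : C, ∃ s ∈ nonZeroDivisors B, ∃ a, f s * c = f a) : IsBirationalHom f := by
  refine ⟨hle, ?_, ?_⟩
  · rw [injective_iff_map_eq_zero]
    intro x hx
    obtain ⟨⟨a, s⟩, rfl⟩ := IsLocalization.mk'_surjective (nonZeroDivisors B) x
    rw [IsLocalization.map_mk'] at hx
    obtain ⟨m, hm⟩ := (IsLocalization.mk'_eq_zero_iff (M := nonZeroDivisors C)
      (S := FractionRing C) (f a) ⟨f s, hle s.2⟩).1 hx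
    have h0 : f a = 0 := mem_nonZeroDivisors_iff_right.1 m.2 _ (by rw [mul_comm]; exact hm)
    have : a = 0 := hinj (by rw [h0, map_zero])
    change IsLocalization.mk' (FractionRing B) a s = 0
    rw [this, IsLocalization.mk'_zero]
  · intro y
    obtain ⟨⟨c, t⟩, rfl⟩ := IsLocalization.mk'_surjective (nonZeroDivisors C) y
    obtain ⟨s, hs, a, ha⟩ := H c
    obtain ⟨s', hs', a', ha'⟩ := H t
    have hfa' : f a' ∈ nonZeroDivisors C := by
      rw [← ha']; exact mul_mem (hle hs') t.2
    have hna' : a' ∈ nonZeroDivisors B := by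
      rw [mem_nonZeroDivisors_iff_right]
      intro x hx
      apply hinj
      rw [map_zero]
      apply mem_nonZeroDivisors_iff_right.1 hfa'
      rw [← map_mul, hx, map_zero]
    refine ⟨IsLocalization.mk' _ (a * s') (⟨s * a', mul_mem hs hna'⟩ : nonZeroDivisors B), ?_⟩
    rw [IsLocalization.map_mk']
    apply IsLocalization.mk'_eq_of_eq
    simp only [map_mul, ← ha, ← ha']
    ring

end

section
variable {R : Type u} [CommRing R]

lemma mem_conductorIdeal_iff (r : R) : r ∈ conductorIdeal R ↔
    ∀ n : integralClosure R (FractionRing R), ∃ r' : R, algebraMap R _ r' = r • n := by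
  unfold conductorIdeal
  rw [Module.mem_annihilator]
  constructor
  · intro h n
    have := h (Submodule.Quotient.mk n)
    rw [← Submodule.Quotient.mk_smul, Submodule.Quotient.mk_eq_zero] at this
    exact this
  · intro h m
    obtain ⟨n, rfl⟩ := Submodule.Quotient.mk_surjective _ m
    rw [← Submodule.Quotient.mk_smul, Submodule.Quotient.mk_eq_zero]
    exact h n

lemma exists_of_mem_map (x : integralClosure R (FractionRing R))
    (hx : x ∈ (conductorIdeal R).map (algebraMap R (integralClosure R (FractionRing R)))) :
    ∃ r ∈ conductorIdeal R, algebraMap R _ r = x := by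
  induction hx using Submodule.span_induction with
  | mem x h => obtain ⟨r, hr, rfl⟩ := h; exact ⟨r, hr, rfl⟩
  | zero => exact ⟨0, zero_mem _, map_zero _⟩
  | add x y _ _ hx hy =>
    obtain ⟨r, hr, rfl⟩ := hx
    obtain ⟨r', hr', rfl⟩ := hy
    exact ⟨r + r', add_mem hr hr', map_add _ _ _⟩
  | smul n x _ hx =>
    obtain ⟨r, hr, rfl⟩ := hx
    obtain ⟨r', hr'⟩ := (mem_conductorIdeal_iff r).1 hr n
    refine ⟨r', ?_, ?_⟩
    · rw [mem_conductorIdeal_iff]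
      intro m
      obtain ⟨r'', hr''⟩ := (mem_conductorIdeal_iff r).1 hr (n * m)
      refine ⟨r'', ?_⟩
      rw [hr'', Algebra.smul_def r' m, hr', Algebra.smul_mul_assoc]
    · rw [hr', Algebra.smul_def, smul_eq_mul, mul_comm]

lemma aQuotMk_surjective : Function.Surjective (aQuotMk R) := Ideal.Quotient.mk_surjective

lemma nQuotMk_surjective : Function.Surjective (nQuotMk R) := Ideal.Quotient.mk_surjective

lemma ker_aQuotMk : RingHom.ker (aQuotMk R) = (conductorIdeal R).radical := Ideal.mk_ker

lemma condQuotMap_mk (r : R) : condQuotMap R (aQuotMk R r) = nQuotMk R (algebraMap R _ r) := rfl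

/-- The map from `R / √c` to `D` satisfies the elementwise condition. -/
lemma subI_D (SA : Subalgebra (AQuot R) (FractionRing (AQuot R)))
    (hSA : IsSeminormalization (AQuot R) SA)
    (j : ↥SA →+* FractionRing (NQuot R)) (hjinj : Function.Injective j)
    (hjcomp : ∀ a : AQuot R,
      j (algebraMap (AQuot R) ↥SA a) =
        algebraMap (NQuot R) (FractionRing (NQuot R)) (condQuotMap R a))
    (D : Subring (NQuot R))
    (hD : D = Subring.comap (algebraMap (NQuot R) (FractionRing (NQuot R)))
        (RingHom.range (R := ↥SA) (S := FractionRing (NQuot R)) j)) :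
    ∃ h : AQuot R →+* D, (∀ a, (h a : NQuot R) = condQuotMap R a) ∧ SubI h := by
  have hmem : ∀ a : AQuot R, condQuotMap R a ∈ D := by
    intro a
    rw [hD]
    exact ⟨_, hjcomp a⟩
  let h : AQuot R →+* D := (condQuotMap R).codRestrict D hmem
  have hlift : ∀ d : D, ∃ x : SA, j x = algebraMap (NQuot R) (FractionRing (NQuot R)) d := by
    intro d
    exact hD.le d.2
  let e : SA ≃+* j.range := RingEquiv.ofBijective j.rangeRestrict
    ⟨fun x y hxy => hjinj (congrArg Subtype.val hxy), j.rangeRestrict_surjective⟩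
  let k₀ : D →+* j.range := ((algebraMap (NQuot R) (FractionRing (NQuot R))).comp D.subtype).codRestrict
    j.range hlift
  let k : D →+* SA := (e.symm : j.range →+* SA).comp k₀
  have hk : ∀ d, j (k d) = algebraMap (NQuot R) (FractionRing (NQuot R)) d := by
    intro d
    have : e (k d) = k₀ d := e.apply_symm_apply _
    exact congrArg Subtype.val this
  have hkinj : Function.Injective k := by
    intro d d' hdd
    have := congrArg j hdd
    rw [hk, hk] at this
    exact Subtype.ext (IsFractionRing.injective _ _ this)
  have hkh : k.comp h = algebraMap (AQuot R) SA := by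
    ext a
    apply congrArg Subtype.val
    apply hjinj
    rw [hjcomp]
    exact hk _
  have hki : k.IsIntegral := by
    apply RingHom.IsIntegral.tower_top h
    rw [hkh]
    intro x
    have h1 : IsIntegral (AQuot R) (x : FractionRing (AQuot R)) := hSA.1 x.2
    exact (isIntegral_algHom_iff SA.val Subtype.val_injective).1 h1
  refine ⟨h, fun a => rfl, ?_⟩
  intro p hp d
  obtain ⟨s, a, hs, H⟩ := hSA.subI p hp (k d)
  refine ⟨s, a, hs, fun q hq hqp => ?_⟩
  obtain ⟨Q, hQ, rfl⟩ := exists_prime_over k hkinj hki q hq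
  rw [Ideal.comap_comap, hkh] at hqp
  have := H Q hQ hqp
  rw [Ideal.mem_comap, map_sub, map_mul]
  rw [← hkh] at this
  exact this

end

/-- With `D = (R/√(cR))^SN ∩ (R^N/√(c R^N))` and `C` the pullback of
`R^N → R^N/√(c R^N) ← D`: the ring `C` embeds into `R^N` (via the first projection), the
induced map `g : R^SN → C` (the one compatible with the inclusions into `R^N`) is an
injection which is birational (it induces an isomorphism of total rings of fractions), and
`g` is in fact an isomorphism. -/
theorem statement4 (R : Type) [CommRing R] [IsReduced R] [IsNoetherianRing R]
    [Module.Finite R ↥(integralClosure R (FractionRing R))]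
    (SR : Subalgebra R (FractionRing R)) (hSR : IsSeminormalization R SR)
    (SA : Subalgebra (AQuot R) (FractionRing (AQuot R)))
    (hSA : IsSeminormalization (AQuot R) SA)
    (j : ↥SA →+* FractionRing (NQuot R)) (hjinj : Function.Injective j)
    (hjcomp : ∀ a : AQuot R,
      j (algebraMap (AQuot R) ↥SA a) =
        algebraMap (NQuot R) (FractionRing (NQuot R)) (condQuotMap R a)) :
    ∀ D : Subring (NQuot R),
      D = Subring.comap (algebraMap (NQuot R) (FractionRing (NQuot R)))
        (RingHom.range (R := ↥SA) (S := FractionRing (NQuot R)) j) →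
    ∀ C : Subring (↥(integralClosure R (FractionRing R)) × ↥D),
      C = ringPullback (nQuotMk R) D.subtype →
    Function.Injective
      ((RingHom.fst ↥(integralClosure R (FractionRing R)) ↥D).comp C.subtype) ∧
    ∀ g : ↥SR →+* ↥C,
      (∀ s : ↥SR, ((g s).1.1 : FractionRing R) = (s : FractionRing R)) →
      Function.Injective g ∧ IsBirationalHom g ∧ Function.Bijective g := by
  intro D hD C hC
  have hinj : Function.Injective
      ((RingHom.fst ↥(integralClosure R (FractionRing R)) ↥D).comp C.subtype) := by
    rintro ⟨⟨n, d⟩, hx⟩ ⟨⟨n', d'⟩, hy⟩ hxy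
    have hn : n = n' := hxy
    subst hn
    rw [hC] at hx hy
    have h1 : nQuotMk R n = d := hx
    have h2 : nQuotMk R n = d' := hy
    have : d = d' := Subtype.ext (h1.symm.trans h2)
    subst this
    rfl
  refine ⟨hinj, ?_⟩
  intro g hg
  have hval : ∀ x y : C, (x.1.1 : FractionRing R) = y.1.1 → x = y :=
    fun x y h => hinj (Subtype.ext h)
  have hCmem : ∀ x : C, nQuotMk R x.1.1 = x.1.2 := by
    intro x
    exact hC.le x.2
  have hginj : Function.Injective g := by
    intro s t hst
    apply Subtype.ext
    rw [← hg, ← hg, hst]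
  obtain ⟨h, hh, hSubD⟩ := subI_D SA hSA j hjinj hjcomp D hD
  -- the structure map
  let ι : R →+* C := g.comp (algebraMap R SR)
  have hι1 : ∀ r, (ι r).1.1 = algebraMap R (integralClosure R (FractionRing R)) r := by
    intro r
    exact Subtype.ext (hg _)
  have hι2 : ∀ r, (ι r).1.2 = h (aQuotMk R r) := by
    intro r
    apply Subtype.ext
    rw [← hCmem, hι1, hh, condQuotMap_mk]
  let π : C →+* D := (RingHom.snd _ _).comp C.subtype
  have hπ : Function.Surjective π := by
    intro d
    obtain ⟨n, hn⟩ := nQuotMk_surjective (d : NQuot R)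
    refine ⟨⟨(n, d), ?_⟩, rfl⟩
    rw [hC]
    exact hn
  have hπι : π.comp ι = h.comp (aQuotMk R) := RingHom.ext hι2
  have hSub : SubI ι := by
    intro p hp b
    by_cases hcp : conductorIdeal R ≤ p
    · have hrad : RingHom.ker (aQuotMk R) ≤ p := by
        rw [ker_aQuotMk]
        exact hp.radical_le_iff.2 hcp
      have hp' : (p.map (aQuotMk R)).IsPrime :=
        Ideal.map_isPrime_of_surjective aQuotMk_surjective hrad
      obtain ⟨s, a, hs, H⟩ := hSubD _ hp' (π b)
      obtain ⟨s, rfl⟩ := aQuotMk_surjective s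
      obtain ⟨a, rfl⟩ := aQuotMk_surjective a
      refine ⟨s, a, fun hc => hs (Ideal.mem_map_of_mem _ hc), ?_⟩
      intro q hq hqp
      have hker : RingHom.ker π ≤ q := by
        intro x hx
        have hx2 : x.1.2 = 0 := hx
        have hx1 : nQuotMk R x.1.1 = 0 := by rw [hCmem, hx2]; rfl
        have hx3 : x.1.1 ∈ ((conductorIdeal R).map
            (algebraMap R ↥(integralClosure R (FractionRing R)))).radical :=
          Ideal.Quotient.eq_zero_iff_mem.1 hx1
        obtain ⟨n, hn⟩ := hx3
        obtain ⟨r, hr, hrx⟩ := exists_of_mem_map _ hn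
        have e : x ^ n = ι r := by
          apply hval
          rw [hι1, hrx]
          rfl
        have : r ∈ q.comap ι := by rw [hqp]; exact hcp hr
        apply hq.mem_of_pow_mem n
        rw [e]
        exact this
      have hq' : (q.map π).IsPrime := Ideal.map_isPrime_of_surjective hπ hker
      have hcm : (q.map π).comap π = q := by
        rw [Ideal.comap_map_of_surjective' π hπ, sup_eq_left]
        exact hker
      have hover : (q.map π).comap h = p.map (aQuotMk R) := by
        have e1 : ((q.map π).comap h).comap (aQuotMk R) = p := by
          rw [Ideal.comap_comap, ← hπι, ← Ideal.comap_comap, hcm, hqp]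
        rw [← e1, Ideal.map_comap_of_surjective _ aQuotMk_surjective]
      have := H _ hq' hover
      rw [← hcm, Ideal.mem_comap, map_sub, map_mul]
      have e2 : ∀ r, π (ι r) = h (aQuotMk R r) := hι2
      rw [e2, e2]
      exact this
    · obtain ⟨f, hf, hfp⟩ := Set.not_subset.1 hcp
      obtain ⟨a, ha⟩ := (mem_conductorIdeal_iff f).1 hf b.1.1
      refine ⟨f, a, hfp, fun q _ _ => ?_⟩
      have : ι f * b = ι a := by
        apply hinj
        change (ι f).1.1 * b.1.1 = (ι a).1.1
        rw [hι1, hι1, ha, Algebra.smul_def]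
      rw [this, sub_self]
      exact zero_mem _
  have hSubg : SubI g := by
    intro p hp b
    obtain ⟨s, a, hs, H⟩ := hSub (p.comap (algebraMap R SR)) inferInstance b
    refine ⟨algebraMap R SR s, algebraMap R SR a, hs, fun q hq hqp => ?_⟩
    exact H q hq (by rw [← hqp, Ideal.comap_comap])
  have hfin : g.Finite := by
    apply RingHom.Finite.of_comp_finite (f := algebraMap R SR)
    let _ : Algebra R C := ι.toAlgebra
    let l : C →ₗ[R] integralClosure R (FractionRing R) :=
      { toFun := fun x => x.1.1
        map_add' := fun _ _ => rfl
        map_smul' := fun r x => by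
          rw [Algebra.smul_def, Algebra.smul_def, RingHom.id_apply, ← hι1]
          rfl }
    exact Module.Finite.of_injective l hinj
  have hbir : IsBirationalHom g := by
    apply birational_of g hginj
    · intro t ht
      have hu := isUnit_of_nzd SR t ht
      change g t ∈ nonZeroDivisors C
      rw [mem_nonZeroDivisors_iff_right]
      intro x hx
      apply hval
      have h1 : (x.1.1 : FractionRing R) * (g t).1.1 = 0 :=
        congrArg (fun y : C => (y.1.1 : FractionRing R)) hx
      rw [hg] at h1
      exact (hu.mul_left_eq_zero).1 h1
    · intro x
      obtain ⟨⟨a, s⟩, hs⟩ := IsLocalization.surj (nonZeroDivisors R) (x.1.1 : FractionRing R)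
      refine ⟨algebraMap R SR s, ?_, algebraMap R SR a, ?_⟩
      · rw [mem_nonZeroDivisors_iff_right]
        intro y hy
        have h1 : (y : FractionRing R) * algebraMap R (FractionRing R) s = 0 :=
          congrArg Subtype.val hy
        exact Subtype.ext (((IsLocalization.map_units (FractionRing R) s).mul_left_eq_zero).1 h1)
      · apply hval
        change ((g _).1.1 : FractionRing R) * x.1.1 = (g _).1.1
        rw [hg, hg, mul_comm]
        exact hs
  refine ⟨hginj, hbir, ?_⟩
  exact hSR.2.1 C g hginj hfin hbir
    ⟨hSubg.comap_injective, hfin.to_isIntegral.comap_surjective hginj⟩ hSubg.residue
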